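/- arXiv:2404.03374 — 2 statements merged into one kernel-verified Lean document; each statement's English description precedes it below -/
import Mathlib

section
/- If (ξ_0, ξ_1) is in the kernel of σ_1(ν) and ν_0 ≠ 0, then setting η = ν_0 ξ_0 / |ν_0|², one has σ_0(ν)η = (ξ_0, ξ_1); that is, ker σ_1(ν) ⊆ Im σ_0(ν) when |ν_0| ≠ 0. -/
noncomputable section

variable {n : ℕ} {Sp Sm : Type*}
  [AddCommGroup Sp] [Module ℂ Sp] [AddCommGroup Sm] [Module ℂ Sm]

/-- The symbol `ν_A = -i Σ_j γ_j ν_{Aj}` (on `S⁺`, valued in `S⁻`). -/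
def nuP (γp : Fin n → Sp →ₗ[ℂ] Sm) (ν : Fin 2 × Fin n → ℝ) (A : Fin 2) (x : Sp) : Sm :=
  (-Complex.I) • ∑ j, ((ν (A, j) : ℂ) • γp j x)

/-- The symbol `ν_A = -i Σ_j γ_j ν_{Aj}` (on `S⁻`, valued in `S⁺`). -/
def nuM (γm : Fin n → Sm →ₗ[ℂ] Sp) (ν : Fin 2 × Fin n → ℝ) (A : Fin 2) (y : Sm) : Sp :=
  (-Complex.I) • ∑ j, ((ν (A, j) : ℂ) • γm j y)

/-- The Clifford relations `γ_j γ_k + γ_k γ_j = -2 δ_{jk}` for gamma matrices `γ_j : S± → S∓`. -/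
def CliffordRelPM (γp : Fin n → Sp →ₗ[ℂ] Sm) (γm : Fin n → Sm →ₗ[ℂ] Sp) : Prop :=
  (∀ j k : Fin n, ∀ x : Sp,
      γm j (γp k x) + γm k (γp j x) = if j = k then (-2 : ℂ) • x else 0) ∧
  (∀ j k : Fin n, ∀ y : Sm,
      γp j (γm k y) + γp k (γm j y) = if j = k then (-2 : ℂ) • y else 0)

theorem nuP_smul_aux (γp : Fin n → Sp →ₗ[ℂ] Sm) (ν : Fin 2 × Fin n → ℝ) (A : Fin 2)
    (c : ℂ) (x : Sp) : nuP γp ν A (c • x) = c • nuP γp ν A x := by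
  simp only [nuP, map_smul, Finset.smul_sum]
  refine Finset.sum_congr rfl fun j _ => ?_
  simp only [smul_smul]
  congr 1
  ring

theorem nuP_nuM_aux (γp : Fin n → Sp →ₗ[ℂ] Sm) (γm : Fin n → Sm →ₗ[ℂ] Sp)
    (hγ : CliffordRelPM γp γm) (ν : Fin 2 × Fin n → ℝ) (A : Fin 2) (y : Sm) :
    nuP γp ν A (nuM γm ν A y) = ((∑ j, (ν (A, j)) ^ 2 : ℝ) : ℂ) • y := by
  set S : Sm := ∑ j, ∑ k, ((ν (A, j) : ℂ) * (ν (A, k) : ℂ)) • γp j (γm k y) with hS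
  have h1 : nuP γp ν A (nuM γm ν A y) = (-1 : ℂ) • S := by
    have : nuM γm ν A y = (-Complex.I) • ∑ j, ((ν (A, j) : ℂ) • γm j y) := rfl
    rw [this, nuP_smul_aux]
    simp only [nuP]
    rw [smul_smul]
    congr 1
    · simp
    · rw [hS]
      refine Finset.sum_congr rfl fun j _ => ?_
      simp only [map_sum, map_smul, Finset.smul_sum, smul_smul]
  have h2 : S = ∑ j, ∑ k, ((ν (A, j) : ℂ) * (ν (A, k) : ℂ)) • γp k (γm j y) := by
    rw [hS, Finset.sum_comm]
    refine Finset.sum_congr rfl fun j _ => Finset.sum_congr rfl fun k _ => ?_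
    rw [mul_comm]
  have h3 : (2 : ℂ) • S = (-2 : ℂ) • (((∑ j, (ν (A, j)) ^ 2 : ℝ) : ℂ) • y) := by
    rw [two_smul]
    nth_rewrite 2 [h2]
    rw [hS]
    simp only [← Finset.sum_add_distrib, ← smul_add, hγ.2]
    simp only [smul_ite, smul_zero, Finset.sum_ite_eq, Finset.mem_univ, if_true]
    push_cast
    rw [Finset.sum_smul, Finset.smul_sum]
    refine Finset.sum_congr rfl fun j _ => ?_
    simp only [smul_smul]
    congr 1
    ring
  have h4 : S = (2 : ℂ)⁻¹ • ((2 : ℂ) • S) := by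
    rw [smul_smul]; norm_num
  rw [h1, h4, h3]
  simp only [smul_smul]
  congr 1
  ring

/-- If `(ξ_0, ξ_1)` is in the kernel of
`σ_1(ν)(ξ_0,ξ_1) = (|ν_0|² ξ_1 - ν_1 ν_0 ξ_0, ν_0 ν_1 ξ_1 - |ν_1|² ξ_0)` and `ν_0 ≠ 0`,
then `η = ν_0 ξ_0 / |ν_0|²` satisfies `σ_0(ν) η = (ν_0 η, ν_1 η) = (ξ_0, ξ_1)`;
that is, `ker σ_1(ν) ⊆ Im σ_0(ν)` when `|ν_0| ≠ 0`. -/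
theorem stmt11 (γp : Fin n → Sp →ₗ[ℂ] Sm) (γm : Fin n → Sm →ₗ[ℂ] Sp)
    (hγ : CliffordRelPM γp γm) (ν : Fin 2 × Fin n → ℝ)
    (hν0 : (∑ j, (ν (0, j)) ^ 2) ≠ 0) (ξ0 ξ1 : Sm)
    (hker1 : ((∑ j, (ν (0, j)) ^ 2 : ℝ) : ℂ) • ξ1 - nuP γp ν 1 (nuM γm ν 0 ξ0) = 0)
    (hker2 : nuP γp ν 0 (nuM γm ν 1 ξ1) - ((∑ j, (ν (1, j)) ^ 2 : ℝ) : ℂ) • ξ0 = 0) :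
    nuP γp ν 0 ((((∑ j, (ν (0, j)) ^ 2 : ℝ) : ℂ))⁻¹ • nuM γm ν 0 ξ0) = ξ0 ∧
    nuP γp ν 1 ((((∑ j, (ν (0, j)) ^ 2 : ℝ) : ℂ))⁻¹ • nuM γm ν 0 ξ0) = ξ1 := by
  have hc : ((∑ j, (ν (0, j)) ^ 2 : ℝ) : ℂ) ≠ 0 := by exact_mod_cast hν0
  constructor
  · rw [nuP_smul_aux, nuP_nuM_aux γp γm hγ, smul_smul, inv_mul_cancel₀ hc, one_smul]
  · rw [nuP_smul_aux, ← sub_eq_zero.mp hker1, smul_smul, inv_mul_cancel₀ hc, one_smul]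
end
end

section
/- If u is a monogenic function on a domain Ω ⊆ R^{2n} (i.e. ∇_0 u = ∇_1 u = 0), then each component of u is biharmonic: Δ² u = 0 on Ω; consequently u is real analytic on Ω. -/
open Complex Finset MeasureTheory
open scoped InnerProductSpace

noncomputable section

/-- The space `ℝ^{2n}` of two vector variables `x_A = (x_{A1},…,x_{An})`, `A = 0,1`. -/
abbrev Pt (n : ℕ) := EuclideanSpace ℝ (Fin 2 × Fin n)

variable {n : ℕ} {S : Type*} [NormedAddCommGroup S] [NormedSpace ℂ S]

/-- The partial derivative `∂_{Aj}`. -/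
def pd (A : Fin 2) (j : Fin n) (f : Pt n → S) : Pt n → S :=
  fun x => fderiv ℝ f x (EuclideanSpace.single (A, j) 1)

/-- The Dirac operator `∇_A = Σ_j γ_j ∂_{Aj}` in the `A`-th vector variable. -/
def nabla (γ : Fin n → S →L[ℂ] S) (A : Fin 2) (f : Pt n → S) : Pt n → S :=
  fun x => ∑ j, γ j (pd A j f x)

/-- The Clifford relation `γ_j γ_k + γ_k γ_j = -2 δ_{jk}`. -/
def CliffordRel (γ : Fin n → S →L[ℂ] S) : Prop :=
  ∀ j k : Fin n, ∀ x : S, γ j (γ k x) + γ k (γ j x) = if j = k then (-2 : ℂ) • x else 0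

/-- The standard Laplacian `Σ_{A,j} ∂²_{Aj}` on `ℝ^{2n}` (so `Lap ∘ Lap` is the bi-Laplacian `Δ²`). -/
def Lap (u : Pt n → S) : Pt n → S :=
  fun x => ∑ A : Fin 2, ∑ j, pd A j (pd A j u) x

section HarmAux

open Topology Filter
open scoped ContDiff

theorem sndmax {φ φ1 : ℝ → ℝ} {d : ℝ} (h1 : ∀ᶠ t in 𝓝 (0:ℝ), HasDerivAt φ (φ1 t) t)
    (h2 : HasDerivAt φ1 d 0) (hm : IsLocalMax φ 0) : d ≤ 0 := by
  by_contra! hd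
  have e1 : deriv φ =ᶠ[𝓝 0] φ1 := h1.mono fun t ht => ht.deriv
  have e2 : deriv (deriv φ) 0 = d := by rw [e1.deriv_eq, h2.deriv]
  have hmin : IsLocalMin φ 0 := isLocalMin_of_deriv_deriv_pos (by rw [e2]; exact hd)
    hm.deriv_eq_zero h1.self_of_nhds.continuousAt
  have hc : φ =ᶠ[𝓝 0] fun _ => φ 0 := by
    filter_upwards [hm, hmin] with t a b
    exact le_antisymm a b
  have := (hc.deriv).deriv_eq
  rw [e2] at this
  simp at this
  linarith

variable {ι : Type*} [Fintype ι] [DecidableEq ι] {F F' : Type*} [NormedAddCommGroup F] [NormedSpace ℝ F]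
  [NormedAddCommGroup F'] [NormedSpace ℝ F']

def bv (i : ι) : EuclideanSpace ℝ ι := EuclideanSpace.single i 1

def HarmOn (Ω : Set (EuclideanSpace ℝ ι)) (u : EuclideanSpace ℝ ι → F) : Prop :=
  (∀ x ∈ Ω, ContDiffAt ℝ ∞ u x) ∧ ∀ x ∈ Ω, ∑ i, fderiv ℝ (fderiv ℝ u) x (bv i) (bv i) = 0

theorem cd_fderiv {E : Type*} [NormedAddCommGroup E] [NormedSpace ℝ E] {u : E → F} {x : E} (h : ContDiffAt ℝ ∞ u x) : ContDiffAt ℝ ∞ (fderiv ℝ u) x :=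
  h.fderiv_right (by simp)

theorem cd_diff {E : Type*} [NormedAddCommGroup E] [NormedSpace ℝ E] {u : E → F} {x : E} (h : ContDiffAt ℝ ∞ u x) : DifferentiableAt ℝ u x :=
  h.differentiableAt (by simp)

theorem cd_symm {E : Type*} [NormedAddCommGroup E] [NormedSpace ℝ E] {u : E → F} {x : E} (h : ContDiffAt ℝ ∞ u x) (a b : E) :
    fderiv ℝ (fderiv ℝ u) x a b = fderiv ℝ (fderiv ℝ u) x b a :=
  (h.isSymmSndFDerivAt (by simp; exact (WithTop.coe_le_coe.2 le_top : ((2:ℕ∞):WithTop ℕ∞) ≤ ∞))).eq a b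

theorem HarmOn.clm {Ω : Set (EuclideanSpace ℝ ι)} (hΩ : IsOpen Ω) {u : EuclideanSpace ℝ ι → F}
    (h : HarmOn Ω u) (L : F →L[ℝ] F') : HarmOn Ω (fun x => L (u x)) := by
  refine ⟨fun x hx => L.contDiff.contDiffAt.comp x (h.1 x hx), fun x hx => ?_⟩
  have e1 : fderiv ℝ (fun x => L (u x)) =ᶠ[𝓝 x]
      fun y => (ContinuousLinearMap.compL ℝ _ F F' L) (fderiv ℝ u y) := by
    filter_upwards [hΩ.mem_nhds hx] with y hy
    exact (L.hasFDerivAt.comp y (cd_diff (h.1 y hy)).hasFDerivAt).fderiv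
  have e2 : fderiv ℝ (fderiv ℝ (fun x => L (u x))) x =
      (ContinuousLinearMap.compL ℝ _ F F' L).comp (fderiv ℝ (fderiv ℝ u) x) := by
    rw [e1.fderiv_eq]
    exact (ContinuousLinearMap.hasFDerivAt _).comp x (cd_diff (cd_fderiv (h.1 x hx))).hasFDerivAt |>.fderiv
  rw [e2]
  have := congrArg L (h.2 x hx)
  simpa using this

theorem HarmOn.fd {Ω : Set (EuclideanSpace ℝ ι)} (hΩ : IsOpen Ω) {u : EuclideanSpace ℝ ι → F}
    (h : HarmOn Ω u) : HarmOn Ω (fderiv ℝ u) := by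
  refine ⟨fun x hx => cd_fderiv (h.1 x hx), fun x hx => ?_⟩
  have c1 := cd_fderiv (h.1 x hx)
  have c2 := cd_fderiv c1
  have d2 := (cd_diff c2).hasFDerivAt
  have key : ∀ a b : EuclideanSpace ℝ ι,
      HasFDerivAt (fun y => fderiv ℝ (fderiv ℝ u) y a b)
      (((ContinuousLinearMap.apply ℝ F b).comp (ContinuousLinearMap.apply ℝ _ a)).comp
        (fderiv ℝ (fderiv ℝ (fderiv ℝ u)) x)) x := fun a b =>
    HasFDerivAt.comp (g := fun T => ((ContinuousLinearMap.apply ℝ F b).comp (ContinuousLinearMap.apply ℝ _ a)) T) x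
      (ContinuousLinearMap.hasFDerivAt _) d2
  have sw : ∀ a b c : EuclideanSpace ℝ ι, fderiv ℝ (fderiv ℝ (fderiv ℝ u)) x c a b
      = fderiv ℝ (fderiv ℝ (fderiv ℝ u)) x c b a := by
    intro a b c
    have e : (fun y => fderiv ℝ (fderiv ℝ u) y a b) =ᶠ[𝓝 x] (fun y => fderiv ℝ (fderiv ℝ u) y b a) := by
      filter_upwards [hΩ.mem_nhds hx] with y hy
      exact cd_symm (h.1 y hy) a b
    have := e.fderiv_eq (𝕜 := ℝ)
    rw [(key a b).fderiv, (key b a).fderiv] at this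
    simpa using congrArg (fun L => L c) this
  refine ContinuousLinearMap.ext fun w => ?_
  have e : (fun y => ∑ i, fderiv ℝ (fderiv ℝ u) y (bv i) (bv i)) =ᶠ[𝓝 x] fun _ => 0 := by
    filter_upwards [hΩ.mem_nhds hx] with y hy
    exact h.2 y hy
  have e' := e.fderiv_eq (𝕜 := ℝ)
  rw [(HasFDerivAt.fun_sum fun i _ => key (bv i) (bv i)).fderiv] at e'
  have e'' := congrArg (fun L => L w) e'
  simp only [_root_.sum_apply, fderiv_fun_const] at e'' ⊢
  simp only [_root_.zero_apply, Pi.zero_apply, ContinuousLinearMap.comp_apply,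
    ContinuousLinearMap.apply_apply] at e'' ⊢
  rw [← e'']
  refine Finset.sum_congr rfl fun i _ => ?_
  rw [sw, cd_symm c1]

theorem HarmOn.itd {Ω : Set (EuclideanSpace ℝ ι)} (hΩ : IsOpen Ω) {u : EuclideanSpace ℝ ι → F}
    (h : HarmOn Ω u) (k : ℕ) : HarmOn Ω (iteratedFDeriv ℝ k u) := by
  induction k with
  | zero =>
    rw [iteratedFDeriv_zero_eq_comp]
    exact h.clm hΩ ((continuousMultilinearCurryFin0 ℝ (EuclideanSpace ℝ ι) F).symm.toContinuousLinearEquiv.toContinuousLinearMap)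
  | succ k ih =>
    rw [iteratedFDeriv_succ_eq_comp_left]
    exact (ih.fd hΩ).clm hΩ ((continuousMultilinearCurryLeftEquiv ℝ (fun _ : Fin (k+1) => EuclideanSpace ℝ ι) F).symm.toContinuousLinearEquiv.toContinuousLinearMap)

/-- derivatives along lines -/
theorem line1 {E : Type*} [NormedAddCommGroup E] [NormedSpace ℝ E] {u : E → F} {x a : E} {t : ℝ} (h : ContDiffAt ℝ ∞ u (x + t • a)) :
    HasDerivAt (fun t : ℝ => u (x + t • a)) (fderiv ℝ u (x + t • a) a) t := by
  have h1 : HasDerivAt (fun t : ℝ => x + t • a) a t := by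
    simpa using ((hasDerivAt_id t).smul_const a).const_add x
  exact (cd_diff h).hasFDerivAt.comp_hasDerivAt t h1

theorem line2 {E : Type*} [NormedAddCommGroup E] [NormedSpace ℝ E] {u : E → F} {x a : E} (h : ContDiffAt ℝ ∞ u x) :
    HasDerivAt (fun t : ℝ => fderiv ℝ u (x + t • a) a) (fderiv ℝ (fderiv ℝ u) x a a) 0 := by
  have h1 := line1 (u := fderiv ℝ u) (x := x) (a := a) (t := 0) (by simpa using cd_fderiv h)
  simp only [zero_smul, add_zero] at h1
  exact (ContinuousLinearMap.apply ℝ F a).hasFDerivAt.comp_hasDerivAt (0:ℝ) h1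

theorem ladder_taylor {G : ℕ → ℝ → F} {n : ℕ} {C : ℝ}
    (hG : ∀ k, ∀ t ∈ Set.Icc (0:ℝ) 1, HasDerivAt (G k) (G (k+1) t) t)
    (hC : ∀ t ∈ Set.Icc (0:ℝ) 1, ‖G (n+1) t‖ ≤ C) :
    ‖G 0 1 - ∑ k ∈ Finset.range (n+1), ((k.factorial : ℝ)⁻¹) • G k 0‖ ≤ C / n.factorial := by
  have hd : ∀ m : ℕ, ∀ t ∈ Set.Icc (0:ℝ) 1, HasDerivAt
      (fun t => ∑ k ∈ Finset.range (m+1), ((1-t)^k * (k.factorial : ℝ)⁻¹) • G k t)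
      (((1-t)^m * (m.factorial : ℝ)⁻¹) • G (m+1) t) t := by
    intro m t ht
    induction m with
    | zero => simpa using hG 0 t ht
    | succ m ih =>
      have h1 : HasDerivAt (fun t : ℝ => (1-t)^(m+1) * ((m+1).factorial : ℝ)⁻¹)
          (-((1-t)^m * (m.factorial : ℝ)⁻¹)) t := by
        have := ((((hasDerivAt_id t).const_sub 1).pow (m+1)).mul_const ((m+1).factorial : ℝ)⁻¹)
        refine this.congr_deriv ?_
        have : (m.factorial : ℝ) ≠ 0 := by positivity
        rw [Nat.factorial_succ]; push_cast
        simp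
        field_simp
      have := ih.add (h1.smul (hG (m+1) t ht))
      simp_rw [Finset.sum_range_succ _ (m+1)]
      refine this.congr_deriv ?_
      module
  have := norm_image_sub_le_of_norm_deriv_le_segment_01' (C := C / n.factorial)
    (fun t ht => (hd n t ht).hasDerivWithinAt) (fun t ht => by
      rw [norm_smul, Real.norm_of_nonneg (by have := sub_nonneg.2 ht.2.le; positivity)]
      have h0 : 0 ≤ 1 - t := sub_nonneg.2 ht.2.le
      have h1 : (1-t)^n ≤ 1 := pow_le_one₀ h0 (by linarith [ht.1])
      have h2 := hC t ⟨ht.1, ht.2.le⟩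
      rw [div_eq_mul_inv, mul_comm C]
      gcongr
      exact mul_le_of_le_one_left (by positivity) h1)
  convert this using 2
  congr 1
  · rw [Finset.sum_range_succ']
    simp
  · simp

theorem norm_line (y : EuclideanSpace ℝ ι) (i : ι) (t : ℝ) :
    ‖y + t • bv i‖ ^ 2 = ‖y‖ ^ 2 + 2 * t * y i + t ^ 2 := by
  rw [norm_add_sq_real, inner_smul_right, norm_smul, bv]
  simp [EuclideanSpace.inner_single_right]
  ring

theorem lin_coord (L : EuclideanSpace ℝ ι →L[ℝ] ℝ) (e : EuclideanSpace ℝ ι) :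
    (L e) ^ 2 ≤ ‖e‖ ^ 2 * ∑ i, (L (bv i)) ^ 2 := by
  have h : e = ∑ i, e i • bv i := by
    ext j
    simp [bv, Pi.single_apply]
  have h2 : L e = ∑ i, e i * L (bv i) := by
    conv_lhs => rw [h]
    simp
  rw [h2, EuclideanSpace.real_norm_sq_eq]
  exact Finset.sum_mul_sq_le_sq_mul_sq _ _ _

theorem bernstein_grad {Ω : Set (EuclideanSpace ℝ ι)} (hΩ : IsOpen Ω) {G : EuclideanSpace ℝ ι → ℝ}
    (h : HarmOn Ω G) {x0 e : EuclideanSpace ℝ ι} {r M : ℝ} (hr : 0 < r)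
    (hsub : Metric.closedBall x0 r ⊆ Ω) (hM : ∀ x ∈ Metric.closedBall x0 r, |G x| ≤ M)
    (he : ‖e‖ = 1) :
    r ^ 4 * (fderiv ℝ G x0 e) ^ 2 ≤ (2 * Fintype.card ι + 12) * r ^ 2 * M ^ 2 := by
  set lam : ℝ := (2 * Fintype.card ι + 12) * r ^ 2 with hlam
  have hlam0 : 0 ≤ lam := by positivity
  set v : EuclideanSpace ℝ ι → ℝ := fun x => fderiv ℝ G x e with hv
  have hvH : HarmOn Ω v := (h.fd hΩ).clm hΩ (ContinuousLinearMap.apply ℝ ℝ e)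
  set η : EuclideanSpace ℝ ι → ℝ := fun x => r ^ 2 - ‖x - x0‖ ^ 2 with hη
  have hN : 0 < Fintype.card ι := by
    by_contra hc
    have : IsEmpty ι := Fintype.card_eq_zero_iff.1 (by omega)
    have : e = 0 := Subsingleton.elim _ _
    simp [this] at he
  suffices H : ∀ ε : ℝ, 0 < ε → r ^ 4 * v x0 ^ 2 ≤ lam * M ^ 2 + ε by
    exact le_of_forall_pos_le_add H
  intro ε' hε'
  obtain ⟨ε, hε, hεr⟩ : ∃ ε : ℝ, 0 < ε ∧ ε * r ^ 2 = ε' := ⟨ε' / r ^ 2, by positivity, by field_simp⟩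
  set W : EuclideanSpace ℝ ι → ℝ := fun x => η x ^ 2 * v x ^ 2 + lam * G x ^ 2 - ε * η x with hW
  have hcont : ContinuousOn W (Metric.closedBall x0 r) := by
    have c1 : ContinuousOn G (Metric.closedBall x0 r) := fun x hx =>
      (h.1 x (hsub hx)).continuousAt.continuousWithinAt
    have c2 : ContinuousOn v (Metric.closedBall x0 r) := fun x hx =>
      (hvH.1 x (hsub hx)).continuousAt.continuousWithinAt
    fun_prop
  obtain ⟨x1, hx1, hmax⟩ := (isCompact_closedBall x0 r).exists_isMaxOn
    ⟨x0, Metric.mem_closedBall_self hr.le⟩ hcont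
  have h0 : W x0 ≤ W x1 := hmax (Metric.mem_closedBall_self hr.le)
  have hW0 : W x0 = r ^ 4 * v x0 ^ 2 + lam * G x0 ^ 2 - ε' := by
    have : η x0 = r ^ 2 := by simp [hη]
    simp only [hW, this, ← hεr]; ring
  have hd : ‖x1 - x0‖ ≤ r := by simpa [dist_eq_norm] using hx1
  have hGM : G x1 ^ 2 ≤ M ^ 2 := sq_le_sq' (by linarith [(abs_le.1 (hM x1 hx1)).1]) (abs_le.1 (hM x1 hx1)).2
  rcases hd.lt_or_eq with hlt | heq
  · exfalso
    have hx1o : x1 ∈ Ω := hsub hx1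
    have hloc : ∀ᶠ y in 𝓝 x1, W y ≤ W x1 := by
      have : Metric.ball x0 r ∈ 𝓝 x1 := Metric.isOpen_ball.mem_nhds (by simpa [dist_eq_norm] using hlt)
      filter_upwards [this] with y hy
      exact hmax (Metric.ball_subset_closedBall hy)
    set a := η x1 with ha
    have ha0 : 0 ≤ a := by simp only [ha, hη]; nlinarith [norm_nonneg (x1 - x0)]
    have har : a ≤ r ^ 2 := by simp only [ha, hη]; nlinarith [norm_nonneg (x1 - x0)]
    have hi : ∀ i, (2 * ((-2 * (x1 - x0) i) ^ 2 + a * (-2)) * v x1 ^ 2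
        + 8 * a * (-2 * (x1 - x0) i) * v x1 * fderiv ℝ v x1 (bv i)
        + 2 * a ^ 2 * (fderiv ℝ v x1 (bv i) ^ 2 + v x1 * fderiv ℝ (fderiv ℝ v) x1 (bv i) (bv i)))
        + 2 * lam * (fderiv ℝ G x1 (bv i) ^ 2 + G x1 * fderiv ℝ (fderiv ℝ G) x1 (bv i) (bv i))
        + 2 * ε ≤ 0 := by
      intro i
      have hcl : Tendsto (fun t : ℝ => x1 + t • bv i) (𝓝 0) (𝓝 x1) := by
        have : Continuous (fun t : ℝ => x1 + t • (bv i : EuclideanSpace ℝ ι)) := by fun_prop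
        simpa using this.tendsto 0
      have hηt : ∀ t : ℝ, η (x1 + t • bv i) = a - 2 * t * (x1 - x0) i - t ^ 2 := by
        intro t
        simp only [ha, hη]
        rw [add_sub_right_comm, norm_line]; ring
      have dη : ∀ t : ℝ, HasDerivAt (fun t : ℝ => η (x1 + t • bv i)) (-2 * (x1 - x0) i - 2 * t) t := by
        intro t
        have : HasDerivAt (fun t : ℝ => a - 2 * t * (x1 - x0) i - t ^ 2) (-2 * (x1 - x0) i - 2 * t) t := by
          have := ((((hasDerivAt_id t).const_mul 2).mul_const ((x1 - x0) i)).const_sub a).sub (hasDerivAt_pow 2 t)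
          refine this.congr_deriv ?_
          simp
        exact this.congr_of_eventuallyEq (Eventually.of_forall hηt)
      have dη' : HasDerivAt (fun t : ℝ => -2 * (x1 - x0) i - 2 * t) (-2) 0 := by
        simpa using ((hasDerivAt_id (0:ℝ)).const_mul 2).const_sub (-2 * (x1 - x0) i)
      have hev : ∀ᶠ t : ℝ in 𝓝 0, x1 + t • bv i ∈ Ω := hcl.eventually (hΩ.mem_nhds hx1o)
      have hmaxφ : IsLocalMax (fun t : ℝ => W (x1 + t • bv i)) 0 := by
        have := hcl.eventually hloc
        filter_upwards [this] with t ht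
        simpa using ht
      have z0 : x1 + (0:ℝ) • bv i = x1 := by simp
      have dv := line1 (u := v) (x := x1) (a := bv i) (t := 0) (by simpa using hvH.1 x1 hx1o)
      have dG := line1 (u := G) (x := x1) (a := bv i) (t := 0) (by simpa using h.1 x1 hx1o)
      have dv' := line2 (a := bv i) (hvH.1 x1 hx1o)
      have dG' := line2 (a := bv i) (h.1 x1 hx1o)
      have d1 := dη 0
      refine sndmax (φ := fun t : ℝ => W (x1 + t • bv i)) (φ1 := fun t =>
        2 * (η (x1 + t • bv i) * (-2 * (x1 - x0) i - 2 * t)) * v (x1 + t • bv i) ^ 2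
        + 2 * (η (x1 + t • bv i) ^ 2 * (v (x1 + t • bv i) * fderiv ℝ v (x1 + t • bv i) (bv i)))
        + 2 * lam * (G (x1 + t • bv i) * fderiv ℝ G (x1 + t • bv i) (bv i))
        - ε * (-2 * (x1 - x0) i - 2 * t)) ?_ ?_ hmaxφ
      · filter_upwards [hev] with t ht
        have A := dη t
        have B := line1 (hvH.1 _ ht)
        have C := line1 (h.1 _ ht)
        have := ((((A.pow 2).mul (B.pow 2)).add ((C.pow 2).const_mul lam)).sub (A.const_mul ε))
        refine this.congr_deriv ?_
        simp
        ring
      · have := ((((d1.mul dη').const_mul 2).mul (dv.pow 2)).add (((d1.pow 2).mul (dv.mul dv')).const_mul 2)).add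
          ((dG.mul dG').const_mul (2 * lam)) |>.sub (dη'.const_mul ε)
        refine this.congr_deriv ?_
        simp
        ring
    have hsum := Finset.sum_nonpos fun i (_ : i ∈ Finset.univ) => hi i
    have hv2 := hvH.2 x1 hx1o
    have hG2 := h.2 x1 hx1o
    have hcs := lin_coord (fderiv ℝ G x1) e
    rw [he] at hcs
    have hlow : ∀ i, -6 * (-2 * (x1 - x0) i) ^ 2 * v x1 ^ 2 - 4 * a * v x1 ^ 2
        + (2 * a ^ 2 * v x1) * fderiv ℝ (fderiv ℝ v) x1 (bv i) (bv i)
        + 2 * lam * fderiv ℝ G x1 (bv i) ^ 2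
        + (2 * lam * G x1) * fderiv ℝ (fderiv ℝ G) x1 (bv i) (bv i) + 2 * ε ≤ 
        (2 * ((-2 * (x1 - x0) i) ^ 2 + a * (-2)) * v x1 ^ 2
        + 8 * a * (-2 * (x1 - x0) i) * v x1 * fderiv ℝ v x1 (bv i)
        + 2 * a ^ 2 * (fderiv ℝ v x1 (bv i) ^ 2 + v x1 * fderiv ℝ (fderiv ℝ v) x1 (bv i) (bv i)))
        + 2 * lam * (fderiv ℝ G x1 (bv i) ^ 2 + G x1 * fderiv ℝ (fderiv ℝ G) x1 (bv i) (bv i))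
        + 2 * ε := by
      intro i
      nlinarith [sq_nonneg (a * fderiv ℝ v x1 (bv i) + 2 * (-2 * (x1 - x0) i) * v x1)]
    have hsum2 := (Finset.sum_le_sum fun i (_ : i ∈ Finset.univ) => hlow i).trans hsum
    have hx2 : ∑ i, (x1 - x0) i ^ 2 = ‖x1 - x0‖ ^ 2 := (EuclideanSpace.real_norm_sq_eq _).symm
    simp only [mul_pow, Finset.sum_add_distrib, Finset.sum_sub_distrib, ← Finset.mul_sum, ← Finset.sum_mul, hv2, hG2, hx2,
      Finset.sum_const, Finset.card_univ, nsmul_eq_mul] at hsum2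
    have hNr : (0:ℝ) < Fintype.card ι := by exact_mod_cast hN
    have hvv : v x1 ^ 2 ≤ ∑ i, fderiv ℝ G x1 (bv i) ^ 2 := by simpa using hcs
    have k1 : lam * v x1 ^ 2 ≤ lam * ∑ i, fderiv ℝ G x1 (bv i) ^ 2 := by gcongr
    have k2 : ‖x1 - x0‖ ^ 2 * v x1 ^ 2 ≤ r ^ 2 * v x1 ^ 2 := by gcongr
    have k3 : Fintype.card ι * (a * v x1 ^ 2) ≤ Fintype.card ι * (r ^ 2 * v x1 ^ 2) := by gcongr
    have k4 : lam * v x1 ^ 2 = 2 * (Fintype.card ι * (r ^ 2 * v x1 ^ 2)) + 12 * (r ^ 2 * v x1 ^ 2) := by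
      rw [hlam]; ring
    have k5 : 0 < Fintype.card ι * ε := by positivity
    nlinarith
  · have hW1 : W x1 = lam * G x1 ^ 2 := by
      simp [hW, hη, heq]
    have : lam * G x1 ^ 2 ≤ lam * M ^ 2 := by gcongr
    have : 0 ≤ lam * G x0 ^ 2 := by positivity
    linarith

theorem grad_est {Ω : Set (EuclideanSpace ℝ ι)} (hΩ : IsOpen Ω) {u : EuclideanSpace ℝ ι → F}
    (h : HarmOn Ω u) {x0 : EuclideanSpace ℝ ι} {r M : ℝ} (hr : 0 < r)
    (hsub : Metric.closedBall x0 r ⊆ Ω) (hM : ∀ x ∈ Metric.closedBall x0 r, ‖u x‖ ≤ M) :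
    ‖fderiv ℝ u x0‖ ≤ (2 * Fintype.card ι + 12) / r * M := by
  have hM0 : 0 ≤ M := (norm_nonneg _).trans (hM x0 (Metric.mem_closedBall_self hr.le))
  refine ContinuousLinearMap.opNorm_le_of_unit_norm (by positivity) fun e he => ?_
  obtain ⟨g, hg, hge⟩ := exists_dual_vector'' ℝ (fderiv ℝ u x0 e)
  have hb := bernstein_grad (M := M) hΩ (h.clm hΩ g) hr hsub (fun x hx => by
    have := g.le_of_opNorm_le hg (u x)
    rw [Real.norm_eq_abs] at this
    linarith [hM x hx]) he
  have hf : fderiv ℝ (fun x => g (u x)) x0 e = ‖fderiv ℝ u x0 e‖ := by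
    have hgd : HasFDerivAt (fun x => g (u x)) (g.comp (fderiv ℝ u x0)) x0 :=
      g.hasFDerivAt.comp x0 (cd_diff (h.1 x0 (hsub (Metric.mem_closedBall_self hr.le)))).hasFDerivAt
    rw [hgd.fderiv]
    simpa using hge
  rw [hf] at hb
  set N : ℝ := 2 * Fintype.card ι + 12 with hN
  have hN1 : 1 ≤ N := by have : (0:ℝ) ≤ Fintype.card ι := by positivity
                         linarith
  have h2 : (r * ‖fderiv ℝ u x0 e‖) ^ 2 ≤ (N * M) ^ 2 := by
    have h3 : r ^ 2 * (r * ‖fderiv ℝ u x0 e‖) ^ 2 ≤ r ^ 2 * (N * M ^ 2) := by linarith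
    have h4 := le_of_mul_le_mul_left h3 (by positivity)
    have h5 : N * M ^ 2 ≤ N ^ 2 * M ^ 2 := by
      gcongr
      nlinarith
    linarith
  have h6 := abs_le_of_sq_le_sq' h2 (by positivity)
  rw [div_mul_eq_mul_div, le_div_iff₀ hr]
  linarith [h6.2]

theorem iter_est {Ω : Set (EuclideanSpace ℝ ι)} (hΩ : IsOpen Ω) {u : EuclideanSpace ℝ ι → F}
    (h : HarmOn Ω u) {x0 : EuclideanSpace ℝ ι} {R M s : ℝ} (hs : 0 < s)
    (hsub : Metric.closedBall x0 R ⊆ Ω) (hM : ∀ x ∈ Metric.closedBall x0 R, ‖u x‖ ≤ M) (k : ℕ) :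
    ∀ x, dist x x0 + k * s ≤ R → ‖iteratedFDeriv ℝ k u x‖ ≤ ((2 * Fintype.card ι + 12) / s) ^ k * M := by
  induction k with
  | zero =>
    intro x hx
    simpa using hM x (by simpa using hx)
  | succ k ih =>
    intro x hx
    push_cast at hx
    have hk : 0 ≤ k * s := by positivity
    rw [← norm_fderiv_iteratedFDeriv]
    have hd : ∀ y ∈ Metric.closedBall x s, dist y x0 + k * s ≤ R := by
      intro y hy
      have := dist_triangle y x x0
      have := Metric.mem_closedBall.1 hy
      linarith
    have := grad_est hΩ (h.itd hΩ k) hs (fun y hy => hsub (by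
      have := hd y hy
      rw [Metric.mem_closedBall]
      linarith)) (fun y hy => ih y (hd y hy))
    rw [pow_succ']
    linarith

theorem fact_est {Ω : Set (EuclideanSpace ℝ ι)} (hΩ : IsOpen Ω) {u : EuclideanSpace ℝ ι → F}
    (h : HarmOn Ω u) {x0 : EuclideanSpace ℝ ι} (hx0 : x0 ∈ Ω) :
    ∃ ρ M A : ℝ, 0 < ρ ∧ 0 < A ∧ Metric.closedBall x0 ρ ⊆ Ω ∧ ∀ k : ℕ, ∀ x ∈ Metric.closedBall x0 ρ,
      ‖iteratedFDeriv ℝ k u x‖ ≤ M * A ^ k * k.factorial := by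
  obtain ⟨R, hR, hsub⟩ := Metric.nhds_basis_closedBall.mem_iff.1 (hΩ.mem_nhds hx0)
  have hc : ContinuousOn u (Metric.closedBall x0 R) := fun x hx =>
      (h.1 x (hsub hx)).continuousAt.continuousWithinAt
  obtain ⟨M, hM⟩ := (isCompact_closedBall x0 R).exists_bound_of_continuousOn hc
  have hM0 : 0 ≤ M := (norm_nonneg _).trans (hM x0 (Metric.mem_closedBall_self hR.le))
  set N : ℝ := 2 * Fintype.card ι + 12 with hN
  have hN0 : 0 < N := by positivity
  refine ⟨R / 2, M, 2 * N * Real.exp 1 / R, by positivity, by positivity,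
    (Metric.closedBall_subset_closedBall (by linarith)).trans hsub, fun k x hx => ?_⟩
  have hx' := Metric.mem_closedBall.1 hx
  rcases Nat.eq_zero_or_pos k with rfl | hk
  · simpa using hM x (Metric.closedBall_subset_closedBall (by linarith) hx)
  have hk' : (0:ℝ) < k := by exact_mod_cast hk
  have h1 := iter_est hΩ h (s := R / (2 * k)) (by positivity) hsub hM k x (by
    have : k * (R / (2 * k)) = R / 2 := by field_simp
    linarith)
  refine h1.trans ?_
  have h2 : (k:ℝ) ^ k ≤ Real.exp 1 ^ k * k.factorial := by
    have := Real.pow_div_factorial_le_exp (x := k) hk'.le k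
    rw [div_le_iff₀ (by positivity)] at this
    rwa [← Real.exp_nat_mul, mul_one]
  calc (N / (R / (2 * k))) ^ k * M = (2 * N / R) ^ k * M * (k:ℝ) ^ k := by
        rw [show N / (R / (2 * k)) = (2 * N / R) * k by field_simp, mul_pow]; ring
    _ ≤ (2 * N / R) ^ k * M * (Real.exp 1 ^ k * k.factorial) := by gcongr
    _ = M * (2 * N * Real.exp 1 / R) ^ k * k.factorial := by
        rw [show 2 * N * Real.exp 1 / R = (2 * N / R) * Real.exp 1 by ring, mul_pow]; ring

theorem analytic_of_bounds {E : Type*} [NormedAddCommGroup E] [NormedSpace ℝ E] {u : E → F} {x0 : E}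
    {ρ M A : ℝ} (hρ : 0 < ρ) (hA : 0 < A)
    (hcd : ∀ x ∈ Metric.closedBall x0 ρ, ContDiffAt ℝ ∞ u x)
    (hb : ∀ k : ℕ, ∀ x ∈ Metric.closedBall x0 ρ,
      ‖iteratedFDeriv ℝ k u x‖ ≤ M * A ^ k * k.factorial) : AnalyticAt ℝ u x0 := by
  set p : FormalMultilinearSeries ℝ E F := fun k => (k.factorial : ℝ)⁻¹ • iteratedFDeriv ℝ k u x0 with hp
  have hM0 : 0 ≤ M := by
    have := hb 0 x0 (Metric.mem_closedBall_self hρ.le)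
    simp only [pow_zero, mul_one, Nat.factorial_zero, Nat.cast_one] at this
    exact (norm_nonneg _).trans this
  have hpk : ∀ k, ‖p k‖ ≤ M * A ^ k := by
    intro k
    rw [hp]
    simp only [norm_smul, norm_inv, RCLike.norm_natCast]
    rw [inv_mul_le_iff₀ (by positivity)]
    linarith [hb k x0 (Metric.mem_closedBall_self hρ.le)]
  set r : NNReal := ⟨min ρ (1 / (2 * A)), by positivity⟩ with hr
  have hrv : (r : ℝ) = min ρ (1 / (2 * A)) := rfl
  have hr0 : 0 < (r : ℝ) := by rw [hrv]; positivity
  have hAr : A * r ≤ 1 / 2 := by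
    have : (r : ℝ) ≤ 1 / (2 * A) := by rw [hrv]; exact min_le_right _ _
    calc A * r ≤ A * (1 / (2 * A)) := by gcongr
      _ = 1 / 2 := by field_simp
  refine ⟨p, r, ?_, by exact_mod_cast hr0, ?_⟩
  · refine p.le_radius_of_bound M fun k => ?_
    calc ‖p k‖ * (r:ℝ) ^ k ≤ M * A ^ k * (r:ℝ) ^ k := by gcongr; exact hpk k
      _ = M * (A * r) ^ k := by rw [mul_pow]; ring
      _ ≤ M * 1 := by
        gcongr
        exact pow_le_one₀ (by positivity) (by linarith)
      _ = M := mul_one M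
  · intro y hy
    have hy' : ‖y‖ < r := by simpa using hy
    set q := A * ‖y‖ with hq
    have hq0 : 0 ≤ q := by positivity
    have hq1 : q < 1 := by
      have : A * ‖y‖ ≤ A * r := by gcongr
      linarith
    have hmem : ∀ t ∈ Set.Icc (0:ℝ) 1, x0 + t • y ∈ Metric.closedBall x0 ρ := by
      intro t ht
      rw [Metric.mem_closedBall, dist_eq_norm, add_sub_cancel_left, norm_smul, Real.norm_of_nonneg ht.1]
      have : (r:ℝ) ≤ ρ := by rw [hrv]; exact min_le_left _ _
      nlinarith [ht.1, ht.2, norm_nonneg y]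
    set G : ℕ → ℝ → F := fun k t => iteratedFDeriv ℝ k u (x0 + t • y) (fun _ => y) with hG
    have hGd : ∀ k, ∀ t ∈ Set.Icc (0:ℝ) 1, HasDerivAt (G k) (G (k+1) t) t := by
      intro k t ht
      have c : ContDiffAt ℝ ∞ (iteratedFDeriv ℝ k u) (x0 + t • y) :=
        (hcd _ (hmem t ht)).iteratedFDeriv_right
          (by exact_mod_cast le_of_eq (top_add (k : ℕ∞)))
      have := line1 c
      have h2 := (ContinuousMultilinearMap.apply ℝ (fun _ : Fin k => E) F (fun _ => y)).hasFDerivAt.comp_hasDerivAt t this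
      refine h2.congr_deriv ?_
      simp only [hG, iteratedFDeriv_succ_apply_left]
      rfl
    have hGb : ∀ k, ∀ t ∈ Set.Icc (0:ℝ) 1, ‖G k t‖ ≤ M * q ^ k * k.factorial := by
      intro k t ht
      refine (ContinuousMultilinearMap.le_opNorm _ _).trans ?_
      simp only [Finset.prod_const, Finset.card_univ, Fintype.card_fin]
      calc _ ≤ (M * A ^ k * k.factorial) * ‖y‖ ^ k := by gcongr; exact hb k _ (hmem t ht)
        _ = _ := by rw [hq, mul_pow]; ring
    have hterm : ∀ k, p k (fun _ => y) = (k.factorial : ℝ)⁻¹ • G k 0 := by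
      intro k
      simp [hp, hG]
    have hsn : Summable fun k => ‖p k (fun _ => y)‖ := by
      refine Summable.of_nonneg_of_le (fun _ => norm_nonneg _) (fun k => ?_)
        ((summable_geometric_of_lt_one hq0 hq1).mul_left M)
      rw [hterm, norm_smul, norm_inv, RCLike.norm_natCast, inv_mul_le_iff₀ (by positivity)]
      linarith [hGb k 0 (by simp)]
    rw [hasSum_iff_tendsto_nat_of_summable_norm hsn]
    have hlim : Tendsto (fun n : ℕ => M * ((n + 1 : ℕ) * q ^ (n + 1))) atTop (𝓝 0) := by
      have := (tendsto_self_mul_const_pow_of_lt_one hq0 hq1).comp (tendsto_add_atTop_nat 1)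
      simpa using this.const_mul M
    rw [← tendsto_add_atTop_iff_nat 1]
    rw [tendsto_iff_norm_sub_tendsto_zero]
    refine squeeze_zero (fun _ => norm_nonneg _) (fun n => ?_) hlim
    have := ladder_taylor (n := n) hGd (hGb (n+1))
    simp only [hterm]
    rw [norm_sub_rev]
    have e0 : G 0 1 = u (x0 + y) := by simp [hG]
    rw [e0] at this
    refine this.trans (le_of_eq ?_)
    rw [Nat.factorial_succ]
    have : (n.factorial : ℝ) ≠ 0 := by positivity
    push_cast
    field_simp

theorem HarmOn.analytic {Ω : Set (EuclideanSpace ℝ ι)} (hΩ : IsOpen Ω) {u : EuclideanSpace ℝ ι → F}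
    (h : HarmOn Ω u) : AnalyticOnNhd ℝ u Ω := by
  intro x hx
  obtain ⟨ρ, M, A, hρ, hA, hs, hb⟩ := fact_est hΩ h hx
  exact analytic_of_bounds hρ hA (fun y hy => h.1 y (hs hy)) hb

end HarmAux

section
open Topology Filter
open scoped ContDiff

theorem pd_pd {u : Pt n → S} {x : Pt n} (h : ContDiffAt ℝ ∞ u x) (A : Fin 2) (j : Fin n) :
    pd A j (pd A j u) x = fderiv ℝ (fderiv ℝ u) x (bv (A, j)) (bv (A, j)) := by
  have := (ContinuousLinearMap.apply ℝ S (bv (A, j) : Pt n)).hasFDerivAt.comp x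
    (cd_diff (cd_fderiv h)).hasFDerivAt
  have h2 : HasFDerivAt (pd A j u) _ x := this
  rw [pd, h2.fderiv]
  rfl

theorem lapA_zero (γ : Fin n → S →L[ℂ] S) (hγ : CliffordRel γ)
    {Ω : Set (Pt n)} (hΩ : IsOpen Ω) {u : Pt n → S} (hu : ∀ x ∈ Ω, ContDiffAt ℝ ∞ u x) (A : Fin 2)
    (hm : ∀ x ∈ Ω, nabla γ A u x = 0) {x : Pt n} (hx : x ∈ Ω) :
    ∑ j, fderiv ℝ (fderiv ℝ u) x (bv (A, j)) (bv (A, j)) = 0 := by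
  have hd : ∀ j k, γ j ((fderiv ℝ (fderiv ℝ u) x (bv (A, k))) (bv (A, j)))
      = fderiv ℝ (fun y => γ j (pd A j u y)) x (bv (A, k)) := by
    intro j k
    have h1 := (ContinuousLinearMap.apply ℝ S (bv (A, j) : Pt n)).hasFDerivAt.comp x
      (cd_diff (cd_fderiv (hu x hx))).hasFDerivAt
    have h2 : HasFDerivAt (fun y => γ j (pd A j u y)) _ x :=
      ((γ j).restrictScalars ℝ).hasFDerivAt.comp x h1
    rw [h2.fderiv]
    rfl
  have hdiff : ∀ j, DifferentiableAt ℝ (fun y => γ j (pd A j u y)) x := by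
    intro j
    have h1 := (ContinuousLinearMap.apply ℝ S (bv (A, j) : Pt n)).hasFDerivAt.comp x
      (cd_diff (cd_fderiv (hu x hx))).hasFDerivAt
    have h2 : HasFDerivAt (fun y => γ j (pd A j u y)) _ x :=
      ((γ j).restrictScalars ℝ).hasFDerivAt.comp x h1
    exact h2.differentiableAt
  have h0 : ∀ k, ∑ j, γ j ((fderiv ℝ (fderiv ℝ u) x (bv (A, k))) (bv (A, j))) = 0 := by
    intro k
    have e : (fun y => ∑ j, γ j (pd A j u y)) =ᶠ[𝓝 x] fun _ => 0 := by
      filter_upwards [hΩ.mem_nhds hx] with y hy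
      exact hm y hy
    have e' := e.fderiv_eq (𝕜 := ℝ)
    rw [fderiv_fun_sum fun j _ => hdiff j] at e'
    have e'' := congrArg (fun L => L (bv (A, k))) e'
    simp only [hd]
    simpa using e''
  set D : Fin n → Fin n → S := fun k j => (fderiv ℝ (fderiv ℝ u) x (bv (A, k))) (bv (A, j)) with hD
  have hsym : ∀ k j, D k j = D j k := fun k j => cd_symm (hu x hx) _ _
  have s1 : ∑ k, ∑ j, γ k (γ j (D k j)) = 0 := by
    refine Finset.sum_eq_zero fun k _ => ?_
    rw [← map_sum, h0 k, map_zero]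
  have s2 : ∑ k, ∑ j, γ j (γ k (D k j)) = 0 := by
    rw [Finset.sum_comm, ← s1]
    refine Finset.sum_congr rfl fun k _ => Finset.sum_congr rfl fun j _ => ?_
    rw [hsym]
  have s3 : ∑ k, ∑ j, (γ k (γ j (D k j)) + γ j (γ k (D k j))) = 0 := by
    simp only [Finset.sum_add_distrib, s1, s2, add_zero]
  simp only [hγ _ _ _, Finset.sum_ite_eq, Finset.mem_univ, if_true, ← Finset.smul_sum] at s3
  exact (smul_eq_zero.1 s3).resolve_left (by norm_num)

end

/-- If `u` is a monogenic function on a domain `Ω ⊆ ℝ^{2n}` (i.e. `∇_0 u = ∇_1 u = 0`),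
then `u` is biharmonic: `Δ² u = 0` on `Ω`; consequently `u` is real analytic on `Ω`. -/
theorem stmt14 (γ : Fin n → S →L[ℂ] S) (hγ : CliffordRel γ)
    (Ω : Set (Pt n)) (hΩ : IsOpen Ω) (u : Pt n → S)
    (hu : ContDiffOn ℝ (⊤ : ℕ∞) u Ω)
    (hmono : ∀ x ∈ Ω, nabla γ 0 u x = 0 ∧ nabla γ 1 u x = 0) :
    (∀ x ∈ Ω, Lap (Lap u) x = 0) ∧ AnalyticOnNhd ℝ u Ω := by
  have hcd : ∀ x ∈ Ω, ContDiffAt ℝ (⊤ : ℕ∞) u x := fun x hx => hu.contDiffAt (hΩ.mem_nhds hx)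
  have hL0 : ∀ A : Fin 2, ∀ x ∈ Ω,
      ∑ j, fderiv ℝ (fderiv ℝ u) x (bv (A, j)) (bv (A, j)) = 0 := by
    intro A x hx
    refine lapA_zero γ hγ hΩ hcd A (fun y hy => ?_) hx
    fin_cases A
    · exact (hmono y hy).1
    · exact (hmono y hy).2
  have hH : HarmOn Ω u := by
    refine ⟨hcd, fun x hx => ?_⟩
    rw [Fintype.sum_prod_type]
    exact Finset.sum_eq_zero fun A _ => hL0 A x hx
  have hLap : ∀ x ∈ Ω, Lap u x = 0 := by
    intro x hx
    refine Finset.sum_eq_zero fun A _ => ?_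
    rw [← hL0 A x hx]
    exact Finset.sum_congr rfl fun j _ => pd_pd (hcd x hx) A j
  refine ⟨fun x hx => ?_, hH.analytic hΩ⟩
  have hpd : ∀ (f : Pt n → S), (∀ y ∈ Ω, f y = 0) → ∀ A j, ∀ y ∈ Ω, pd A j f y = 0 := by
    intro f hf A j y hy
    have e : f =ᶠ[nhds y] fun _ => 0 := by
      filter_upwards [hΩ.mem_nhds hy] with z hz
      exact hf z hz
    rw [pd, e.fderiv_eq]
    simp
  exact Finset.sum_eq_zero fun A _ => Finset.sum_eq_zero fun j _ =>
    hpd _ (hpd _ hLap A j) A j x hx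
end
end
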